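/- arXiv:cs/0206018 — 2 statements merged into one kernel-verified Lean document; each statement's English description precedes it below -/
import Mathlib

section
/- There exist a natural number n and three caterpillars C₁, C₂, C₃ on the common vertex set Fin n such that no injective map f : Fin n → ℝ² is simultaneously a crossing-free straight-line drawing of all three of C₁, C₂, C₃. That is, three caterpillar graphs cannot always be simultaneously embedded with a given vertex mapping. -/
def IsCrossingFreeDrawing {V : Type*} (G : SimpleGraph V) (f : V → ℝ × ℝ) : Prop :=
  Function.Injective f ∧
    ∀ a b c d : V, G.Adj a b → G.Adj c d → s(a, b) ≠ s(c, d) →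
      segment ℝ (f a) (f b) ∩ segment ℝ (f c) (f d) = f '' (({a, b} : Set V) ∩ {c, d})

def IsPathGraph {V : Type*} (G : SimpleGraph V) : Prop :=
  ∃ (m : ℕ) (e : Fin m ≃ V), ∀ u v : Fin m,
    G.Adj (e u) (e v) ↔ ((u : ℕ) + 1 = (v : ℕ) ∨ (v : ℕ) + 1 = (u : ℕ))

def IsCaterpillar {V : Type*} (G : SimpleGraph V) : Prop :=
  G.Connected ∧ G.IsAcyclic ∧
    IsPathGraph (G.induce {v : V | 2 ≤ (G.neighborSet v).ncard})

open Filter Topology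

/-- Twice the signed area of the triangle `abc`. -/
def orient (a b c : ℝ × ℝ) : ℝ :=
  (b.1 - a.1) * (c.2 - a.2) - (b.2 - a.2) * (c.1 - a.1)

/-- Whether the triangle `abc` is oriented counterclockwise. -/
noncomputable def side (a b c : ℝ × ℝ) : Bool := decide (0 < orient a b c)

/-- Whether the segments `ab` and `cd` cross, for points in general position. -/
noncomputable def cross (a b c d : ℝ × ℝ) : Bool :=
  (side a b c ^^ side a b d) && (side c d a ^^ side c d b)

/-- Whether `p` lies in the triangle `uvw`, for points in general position. -/
noncomputable def inTriangle (u v w p : ℝ × ℝ) : Bool :=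
  side u v p == side v w p && side v w p == side w u p

/-- Whether `p` is to the left of at least two of the directed lines `uv`, `vw`, `wu`. -/
noncomputable def majoritySide (u v w p : ℝ × ℝ) : Bool :=
  Bool.atLeastTwo (side u v p) (side v w p) (side w u p)

/-- No three points of the family `p` are collinear. -/
def InGeneralPosition {ι : Type*} (p : ι → ℝ × ℝ) : Prop :=
  ∀ i j k, i ≠ j → i ≠ k → j ≠ k → orient (p i) (p j) (p k) ≠ 0

theorem orient_rotate (a b c : ℝ × ℝ) : orient b c a = orient a b c := by
  unfold orient; ring

theorem orient_swap (a b c : ℝ × ℝ) : orient b a c = -orient a b c := by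
  unfold orient; ring

theorem side_rotate (a b c : ℝ × ℝ) : side b c a = side a b c := by
  rw [side, side, orient_rotate]

theorem side_swap {a b c : ℝ × ℝ} (h : orient a b c ≠ 0) : side b a c = !side a b c := by
  rw [side, side, orient_swap]
  rcases h.lt_or_gt with h | h <;> simp [h, h.not_gt]

theorem side_perms {a b c : ℝ × ℝ} (h : orient a b c ≠ 0) :
    side b c a = side a b c ∧ side c a b = side a b c ∧ side b a c = (!side a b c) ∧
      side a c b = (!side a b c) ∧ side c b a = !side a b c :=
  have h' := (side_rotate b a c).trans (side_swap h)
  ⟨side_rotate .., (side_rotate ..).symm, side_swap h, h', (side_rotate a c b).trans h'⟩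

/-- The three products `x * x'`, `-(y * y')`, `z * z'` of a three-term relation cannot have the
same sign. -/
def grassmannPluckerOk (x x' y y' z z' : Bool) : Bool :=
  !((x ^^ x') == (z ^^ z') && (x ^^ x') != (y ^^ y'))

theorem grassmannPluckerOk_side {a b c d e : ℝ × ℝ} (h₁ : orient a b c ≠ 0)
    (h₂ : orient a d e ≠ 0) (h₃ : orient a b d ≠ 0) (h₄ : orient a c e ≠ 0)
    (h₅ : orient a b e ≠ 0) (h₆ : orient a c d ≠ 0) :
    grassmannPluckerOk (side a b c) (side a d e) (side a b d) (side a c e)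
      (side a b e) (side a c d) := by
  have key : orient a b c * orient a d e - orient a b d * orient a c e
      + orient a b e * orient a c d = 0 := by
    unfold orient; ring
  have parity {s t : ℝ} (hs : s ≠ 0) (ht : t ≠ 0) :
      (decide (0 < s) ^^ decide (0 < t)) = decide (s * t < 0) := by
    rcases hs.lt_or_gt with hs | hs <;> rcases ht.lt_or_gt with ht | ht <;>
      simp [hs, ht, mul_neg_iff, hs.not_gt, ht.not_gt]
  simp only [grassmannPluckerOk, side, parity h₁ h₂, parity h₃ h₄, parity h₅ h₆]
  generalize orient a b c * orient a d e = x at key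
  generalize orient a b d * orient a c e = y at key
  generalize orient a b e * orient a c d = z at key
  by_cases hx : x < 0 <;> by_cases hy : y < 0 <;> by_cases hz : z < 0 <;> simp [hx, hy, hz]
  all_goals linarith

/-- The combinatorial core of `InGeneralPosition.five_points`; the bit `abc` stands for the side of
`abc`. -/
theorem five_points_bits : ∀ uvw uvp uvq uwp uwq upq vwp vwq vpq wpq : Bool,
    (grassmannPluckerOk uvw upq uvp uwq uvq uwp &&
      grassmannPluckerOk (!uvw) vpq (!uvp) vwq (!uvq) vwp &&
      grassmannPluckerOk uvw wpq (!uwp) (!vwq) (!uwq) (!vwp) &&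
      grassmannPluckerOk uvp (!wpq) uwp (!vpq) (!upq) vwp &&
      grassmannPluckerOk uvq wpq uwq vpq upq vwq) = true →
    ((upq ^^ vpq) && (uvp ^^ uvq) ^^ (vpq ^^ wpq) && (vwp ^^ vwq) ^^
        (upq ^^ wpq) && (uwp ^^ uwq)) =
      ((uvp == vwp && vwp == !uwp) ^^ (uvq == vwq && vwq == !uwq)) ∧
    ((uvq ^^ !vpq) && (!uvp ^^ upq) ^^ (uwq ^^ !wpq) && (!uwp ^^ upq) ^^
        (uvp ^^ vpq) && (!uvq ^^ !upq) ^^ (uwp ^^ wpq) && (!uwq ^^ !upq) ^^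
        (!vwp ^^ vpq) && (vwq ^^ !wpq) ^^ (!vwq ^^ !vpq) && (vwp ^^ wpq)) =
      !((Bool.atLeastTwo uvp vwp !uwp) ^^ Bool.atLeastTwo uvq vwq !uwq) := by
  decide +kernel

/-- The segment `pq` crosses the triangle `uvw` an even number of times iff both or none of `p`, `q`
lie inside; and a parity relation for the drawing of `K_{3,2}` with parts `{u, v, w}`, `{p, q}`. -/
theorem InGeneralPosition.five_points {ι : Type*} {g : ι → ℝ × ℝ} (hg : InGeneralPosition g)
    {u v w p q : ι} (h : [u, v, w, p, q].Nodup) :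
    (cross (g p) (g q) (g u) (g v) ^^ cross (g p) (g q) (g v) (g w) ^^
        cross (g p) (g q) (g u) (g w)) =
      (inTriangle (g u) (g v) (g w) (g p) ^^ inTriangle (g u) (g v) (g w) (g q)) ∧
    (cross (g v) (g q) (g u) (g p) ^^ cross (g w) (g q) (g u) (g p) ^^
        cross (g v) (g p) (g u) (g q) ^^ cross (g w) (g p) (g u) (g q) ^^
        cross (g v) (g p) (g w) (g q) ^^ cross (g v) (g q) (g w) (g p)) =
      !(majoritySide (g u) (g v) (g w) (g p) ^^ majoritySide (g u) (g v) (g w) (g q)) := by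
  simp only [List.nodup_cons, List.mem_cons, List.not_mem_nil, or_false, not_or, ← ne_eq] at h
  obtain ⟨⟨huv, huw, hup, huq⟩, ⟨hvw, hvp, hvq⟩, ⟨hwp, hwq⟩, hpq, -⟩ := h
  have gp {a b c d e : ι} (hab : a ≠ b) (hac : a ≠ c) (had : a ≠ d) (hae : a ≠ e) (hbc : b ≠ c)
      (hbd : b ≠ d) (hbe : b ≠ e) (hcd : c ≠ d) (hce : c ≠ e) (hde : d ≠ e) :=
    grassmannPluckerOk_side (hg _ _ _ hab hac hbc) (hg _ _ _ had hae hde) (hg _ _ _ hab had hbd)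
      (hg _ _ _ hac hae hce) (hg _ _ _ hab hae hbe) (hg _ _ _ hac had hcd)
  have gu := gp huv huw hup huq hvw hvp hvq hwp hwq hpq
  have gv := gp huv.symm hvw hvp hvq huw hup huq hwp hwq hpq
  have gw := gp huw.symm hvw.symm hwp hwq huv hup huq hvp hvq hpq
  have gp' := gp hup.symm hvp.symm hwp.symm hpq huv huw huq hvw hvq hwq
  have gq := gp huq.symm hvq.symm hwq.symm hpq.symm huv huw hup hvw hvp hwp
  simp only [side_perms (hg _ _ _ huv huw hvw), side_perms (hg _ _ _ huv hup hvp),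
    side_perms (hg _ _ _ huv huq hvq), side_perms (hg _ _ _ huw hup hwp),
    side_perms (hg _ _ _ huw huq hwq), side_perms (hg _ _ _ hup huq hpq),
    side_perms (hg _ _ _ hvw hvp hwp), side_perms (hg _ _ _ hvw hvq hwq),
    side_perms (hg _ _ _ hvp hvq hpq), side_perms (hg _ _ _ hwp hwq hpq),
    cross, inTriangle, majoritySide] at *
  exact five_points_bits (side (g u) (g v) (g w)) _ _ _ _ _ _ _ _ _
    (by simp only [gu, gv, gw, gp', gq, Bool.and_self])

/-- Disjoint segments do not cross combinatorially. -/
theorem cross_eq_false_of_disjoint {a b c d : ℝ × ℝ} (habc : orient a b c ≠ 0)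
    (habd : orient a b d ≠ 0) (hcda : orient c d a ≠ 0) (hcdb : orient c d b ≠ 0)
    (h : Disjoint (segment ℝ a b) (segment ℝ c d)) : cross a b c d = false := by
  have weights {s t : ℝ} (hs : s ≠ 0) (ht : t ≠ 0) (hst : decide (0 < s) ≠ decide (0 < t)) :
      s - t ≠ 0 ∧ 0 ≤ -t / (s - t) ∧ 0 ≤ s / (s - t) ∧ -t / (s - t) + s / (s - t) = 1 := by
    have hne : s - t ≠ 0 := by
      intro e; rw [sub_eq_zero] at e; exact hst (by rw [e])
    refine ⟨hne, ?_, ?_, by field_simp; ring⟩ <;>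
    · rcases hs.lt_or_gt with hs | hs <;> rcases ht.lt_or_gt with ht | ht <;>
        simp [hs, ht, hs.not_gt, ht.not_gt] at hst
      · exact div_nonneg_of_nonpos (by linarith) (by linarith)
      · exact div_nonneg (by linarith) (by linarith)
  by_contra hc
  simp only [cross, side, Bool.not_eq_false, Bool.and_eq_true, bne_iff_ne] at hc
  obtain ⟨h₁, h₂, h₃, h₄⟩ := weights habc habd hc.1
  obtain ⟨k₁, k₂, k₃, k₄⟩ := weights hcda hcdb hc.2
  refine Set.disjoint_left.mp h ⟨_, _, k₂, k₃, k₄, ?_⟩ ⟨_, _, h₂, h₃, h₄, rfl⟩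
  have e : orient c d a - orient c d b = -(orient a b c - orient a b d) := by
    unfold orient; ring
  rw [e] at *
  ext <;> simp only [Prod.fst_add, Prod.snd_add, Prod.smul_fst, Prod.smul_snd, smul_eq_mul] <;>
    field_simp <;> unfold orient <;> ring

theorem eventually_quadratic_ne_zero {α : ℝ} (hα : α ≠ 0) (β γ : ℝ) :
    ∀ᶠ t : ℝ in 𝓝[≠] 0, α * t ^ 2 + β * t + γ ≠ 0 := by
  open Polynomial in
  have hP : C α * X ^ 2 + C β * X + C γ ≠ 0 :=
    leadingCoeff_ne_zero.mp (by rwa [leadingCoeff_quadratic hα])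
  filter_upwards [nhdsNE_le_cofinite 0 (Polynomial.finite_setOfPred_isRoot hP).compl_mem_cofinite]
    with t ht h
  exact ht (by simpa [Polynomial.IsRoot.def] using h)

/-- Moving points along the moment curve makes them generic. -/
theorem eventually_orient_ne_zero (a b c : ℝ × ℝ) {x y z : ℝ} (hxy : x ≠ y) (hxz : x ≠ z)
    (hyz : y ≠ z) : ∀ᶠ t : ℝ in 𝓝[≠] 0,
      orient (a + t • (x, x ^ 2)) (b + t • (y, y ^ 2)) (c + t • (z, z ^ 2)) ≠ 0 := by
  have hα : (y - x) * (z - x) * (z - y) ≠ 0 := by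
    simp [sub_eq_zero, hxy.symm, hxz.symm, hyz.symm]
  convert eventually_quadratic_ne_zero hα ((b.1 - a.1) * (z ^ 2 - x ^ 2) +
    (y - x) * (c.2 - a.2) - (b.2 - a.2) * (z - x) - (y ^ 2 - x ^ 2) * (c.1 - a.1))
    (orient a b c) using 3 with t
  simp [orient]
  ring

theorem eventually_disjoint_segment {α : Type*} {l : Filter α} {a b c d : ℝ × ℝ}
    {a' b' c' d' : α → ℝ × ℝ} (ha : Tendsto a' l (𝓝 a)) (hb : Tendsto b' l (𝓝 b))
    (hc : Tendsto c' l (𝓝 c)) (hd : Tendsto d' l (𝓝 d))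
    (h : Disjoint (segment ℝ a b) (segment ℝ c d)) :
    ∀ᶠ t in l, Disjoint (segment ℝ (a' t) (b' t)) (segment ℝ (c' t) (d' t)) := by
  have hcompact (x y : ℝ × ℝ) : IsCompact (segment ℝ x y) := by
    rw [← convexHull_pair]; exact (Set.toFinite _).isCompact_convexHull (𝕜 := ℝ)
  obtain ⟨φ, s, t, hs, hst, ht⟩ := geometric_hahn_banach_compact_closed (convex_segment a b)
    (hcompact a b) (convex_segment c d) (hcompact c d).isClosed h
  have hφ {x : ℝ × ℝ} {x' : α → ℝ × ℝ} (hx : Tendsto x' l (𝓝 x)) :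
      Tendsto (fun t => φ (x' t)) l (𝓝 (φ x)) := (φ.continuous.tendsto x).comp hx
  filter_upwards [(hφ ha).eventually_lt_const (hs a (left_mem_segment ..)),
    (hφ hb).eventually_lt_const (hs b (right_mem_segment ..)),
    (hφ hc).eventually_const_lt (ht c (left_mem_segment ..)),
    (hφ hd).eventually_const_lt (ht d (right_mem_segment ..))] with τ ha hb hc hd
  refine Set.disjoint_left.mpr fun x hx hx' => ?_
  have h₁ := (convex_halfSpace_lt φ.isLinear s).segment_subset ha hb hx
  have h₂ := (convex_halfSpace_gt φ.isLinear t).segment_subset hc hd hx'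
  exact (h₁.trans hst).not_gt h₂

/-- Finitely many points can be moved into general position keeping disjoint segments disjoint. -/
theorem exists_inGeneralPosition {ι : Type*} [Finite ι] (f : ι → ℝ × ℝ) :
    ∃ g : ι → ℝ × ℝ, InGeneralPosition g ∧ ∀ i j k l,
      Disjoint (segment ℝ (f i) (f j)) (segment ℝ (f k) (f l)) →
        Disjoint (segment ℝ (g i) (g j)) (segment ℝ (g k) (g l)) := by
  obtain ⟨x, hx⟩ : ∃ x : ι → ℝ, Function.Injective x := by
    obtain ⟨n, ⟨e⟩⟩ := Finite.exists_equiv_fin ι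
    exact ⟨fun i => (e i : ℕ), fun i j h => e.injective (Fin.ext (Nat.cast_injective h))⟩
  let g (t : ℝ) (i : ι) : ℝ × ℝ := f i + t • (x i, x i ^ 2)
  have hg (i : ι) : Tendsto (g · i) (𝓝[≠] 0) (𝓝 (f i)) := by
    have : Continuous (g · i) := by fun_prop
    exact (this.tendsto' 0 (f i) (by simp [g])).mono_left nhdsWithin_le_nhds
  have h₁ : ∀ᶠ t in 𝓝[≠] 0, InGeneralPosition (g t) := by
    simp only [InGeneralPosition, eventually_all]
    exact fun i j k hij hik hjk =>
      eventually_orient_ne_zero _ _ _ (hx.ne hij) (hx.ne hik) (hx.ne hjk)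
  have h₂ : ∀ᶠ t in 𝓝[≠] 0, ∀ i j k l,
      Disjoint (segment ℝ (f i) (f j)) (segment ℝ (f k) (f l)) →
        Disjoint (segment ℝ (g t i) (g t j)) (segment ℝ (g t k) (g t l)) := by
    simp only [eventually_all]
    exact fun i j k l => eventually_disjoint_segment (hg i) (hg j) (hg k) (hg l)
  exact (h₁.and h₂).exists.imp' (g ·) fun _ => id

open SimpleGraph

theorem isAcyclic_pathGraph (n : ℕ) : (pathGraph n).IsAcyclic := by
  rw [isAcyclic_iff_forall_adj_isBridge]
  have key {i j : Fin n} (hij : (i : ℕ) + 1 = j) : (pathGraph n).IsBridge s(i, j) := by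
    rw [isBridge_iff]
    rintro ⟨p⟩
    have step {x y : Fin n} (p : ((pathGraph n).deleteEdges {s(i, j)}).Walk x y) :
        x ≤ i ↔ y ≤ i := by
      induction p with
      | nil => rfl
      | cons h _ ih =>
        rw [← ih]
        simp only [deleteEdges_adj, pathGraph_adj, Set.mem_singleton_iff, Sym2.eq_iff,
          Fin.ext_iff] at h
        simp only [Fin.le_def]
        omega
    have := (step p).1 le_rfl
    rw [Fin.le_def] at this
    omega
  intro i j h
  rcases pathGraph_adj.mp h with h | h
  · exact key h
  · rw [Sym2.eq_swap]; exact key h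

theorem isCaterpillar_pathGraph (n : ℕ) : IsCaterpillar (pathGraph (n + 2)) := by
  refine ⟨pathGraph_connected _, isAcyclic_pathGraph _, n, ?_, ?_⟩
  · have interior (v : Fin (n + 2)) :
        2 ≤ ((pathGraph (n + 2)).neighborSet v).ncard ↔ 0 < (v : ℕ) ∧ (v : ℕ) < n + 1 := by
      rw [Nat.succ_le_iff, Set.one_lt_ncard (Set.toFinite _)]
      simp only [mem_neighborSet, pathGraph_adj]
      constructor
      · rintro ⟨a, ha, b, hb, hab⟩
        rw [ne_eq, Fin.ext_iff] at hab
        omega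
      · intro h
        refine ⟨⟨v - 1, by omega⟩, by simp; omega, ⟨v + 1, by omega⟩, by simp, ?_⟩
        simp
    exact
      { toFun u := ⟨⟨u + 1, by omega⟩, (interior _).2 ⟨by simp, by simp⟩⟩
        invFun v := ⟨v.1 - 1, by have := (interior _).1 v.2; omega⟩
        left_inv u := by simp
        right_inv v := by
          have := (interior _).1 v.2
          apply Subtype.ext
          ext
          simp
          omega }
  · intro u v
    simp [pathGraph_adj]

theorem IsCaterpillar.of_iso {V W : Type*} {G : SimpleGraph V} {H : SimpleGraph W} (φ : G ≃g H)
    (h : IsCaterpillar H) : IsCaterpillar G := by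
  obtain ⟨h₁, h₂, m, e, he⟩ := h
  have hs (v : V) : (G.neighborSet v).ncard = (H.neighborSet (φ v)).ncard :=
    Nat.card_congr (φ.mapNeighborSet v)
  refine ⟨φ.connected_iff.2 h₁, φ.isAcyclic_iff.2 h₂, m,
    e.trans (φ.toEquiv.subtypeEquiv fun v => ?_).symm, fun u v => ?_⟩
  · simp [hs]
  · rw [← he]
    exact φ.symm.map_adj_iff

theorem isCaterpillar_comap_pathGraph {V : Type*} {n : ℕ} (e : V ≃ Fin (n + 2)) :
    IsCaterpillar ((pathGraph (n + 2)).comap e) :=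
  (isCaterpillar_pathGraph n).of_iso (.comap e _)

theorem IsCrossingFreeDrawing.disjoint_segment {V : Type*} {G : SimpleGraph V} {f : V → ℝ × ℝ}
    (hf : IsCrossingFreeDrawing G f) {a b c d : V} (hab : G.Adj a b) (hcd : G.Adj c d)
    (hac : a ≠ c) (had : a ≠ d) (hbc : b ≠ c) (hbd : b ≠ d) :
    Disjoint (segment ℝ (f a) (f b)) (segment ℝ (f c) (f d)) := by
  rw [Set.disjoint_iff_inter_eq_empty, hf.2 a b c d hab hcd (by simp [hac, had]),
    Set.image_eq_empty]
  ext x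
  simp only [Set.mem_inter_iff, Set.mem_insert_iff, Set.mem_singleton_iff,
    Set.mem_empty_iff_false, iff_false]
  rintro ⟨rfl | rfl, rfl | rfl⟩ <;> contradiction

/-- Three Hamiltonian paths on `K_{3,3}` with parts `{0, 1, 2}`, `{3, 4, 5}`, where the edges at
`0` are subdivided by `6`, `7`, `8`; vertex `v` has position `pathPosition k v` on the `k`-th. -/
def pathPosition : Fin 3 → Fin 9 ≃ Fin 9
  | 0 => ⟨![1, 6, 4, 5, 3, 7, 0, 2, 8], ![6, 0, 7, 4, 2, 3, 1, 5, 8], by decide, by decide⟩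
  | 1 => ⟨![1, 6, 4, 3, 7, 5, 2, 8, 0], ![8, 0, 6, 3, 2, 5, 1, 4, 7], by decide, by decide⟩
  | 2 => ⟨![1, 6, 4, 7, 5, 3, 8, 0, 2], ![7, 0, 8, 5, 2, 4, 1, 3, 6], by decide, by decide⟩

/-- Two disjoint edges of a common path. -/
def AreDisjointEdges (a b c d : Fin 9) : Prop :=
  (a ≠ c ∧ a ≠ d ∧ b ≠ c ∧ b ≠ d) ∧
    ∃ k, ((pathGraph 9).comap (pathPosition k)).Adj a b ∧
      ((pathGraph 9).comap (pathPosition k)).Adj c d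

instance (a b c d : Fin 9) : Decidable (AreDisjointEdges a b c d) :=
  decidable_of_iff ((a ≠ c ∧ a ≠ d ∧ b ≠ c ∧ b ≠ d) ∧ ∃ k,
      ((pathPosition k a).val + 1 = pathPosition k b ∨
        (pathPosition k b).val + 1 = pathPosition k a) ∧
      ((pathPosition k c).val + 1 = pathPosition k d ∨
        (pathPosition k d).val + 1 = pathPosition k c))
    (by simp only [AreDisjointEdges, comap_adj, pathGraph_adj])

theorem not_forall_cross_eq_false {g : Fin 9 → ℝ × ℝ} (hg : InGeneralPosition g) :
    ¬ ∀ a b c d, AreDisjointEdges a b c d → cross (g a) (g b) (g c) (g d) = false := by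
  intro h
  have spoke (i p q : Fin 9) (hi : [0, i + 3, i, p, q].Nodup ∧ AreDisjointEdges p q 0 (i + 3) ∧
      AreDisjointEdges p q (i + 3) i) : cross (g p) (g q) (g 0) (g i) =
        (inTriangle (g 0) (g (i + 3)) (g i) (g p) ^^ inTriangle (g 0) (g (i + 3)) (g i) (g q)) := by
    simpa [h _ _ _ _ hi.2.1, h _ _ _ _ hi.2.2] using (hg.five_points hi.1).1
  have claw (p q : Fin 9) (hp : [0, 1, 2, p, q].Nodup ∧ AreDisjointEdges 1 p 2 q ∧
      AreDisjointEdges 1 q 2 p) := by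
    simpa only [h _ _ _ _ hp.2.1, h _ _ _ _ hp.2.2, Bool.xor_false] using (hg.five_points hp.1).2
  have h₁ := claw 3 4 (by decide)
  have h₂ := claw 3 5 (by decide)
  have h₃ := claw 4 5 (by decide)
  rw [spoke 3 1 4 (by decide), spoke 3 2 4 (by decide), spoke 4 1 3 (by decide),
    spoke 4 2 3 (by decide)] at h₁
  rw [spoke 3 1 5 (by decide), spoke 3 2 5 (by decide), spoke 5 1 3 (by decide),
    spoke 5 2 3 (by decide)] at h₂
  rw [spoke 4 1 5 (by decide), spoke 4 2 5 (by decide), spoke 5 1 4 (by decide),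
    spoke 5 2 4 (by decide)] at h₃
  have := congrArg₂ xor h₁ (congrArg₂ xor h₂ h₃)
  simp [Bool.xor_left_comm, Bool.xor_comm] at this

/-- Three caterpillar graphs cannot always be simultaneously embedded with a given
vertex mapping: there exist three caterpillars on a common vertex set admitting no
common crossing-free straight-line drawing. -/
theorem three_caterpillars_not_always_simultaneously_embeddable :
    ∃ (n : ℕ) (C₁ C₂ C₃ : SimpleGraph (Fin n)),
      IsCaterpillar C₁ ∧ IsCaterpillar C₂ ∧ IsCaterpillar C₃ ∧
      ∀ f : Fin n → ℝ × ℝ,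
        ¬ (IsCrossingFreeDrawing C₁ f ∧ IsCrossingFreeDrawing C₂ f ∧
           IsCrossingFreeDrawing C₃ f) := by
  refine ⟨9, _, _, _, isCaterpillar_comap_pathGraph (pathPosition 0),
    isCaterpillar_comap_pathGraph (pathPosition 1),
    isCaterpillar_comap_pathGraph (pathPosition 2), ?_⟩
  rintro f ⟨h₀, h₁, h₂⟩
  have hf : ∀ k, IsCrossingFreeDrawing ((pathGraph 9).comap (pathPosition k)) f
    | 0 => h₀ | 1 => h₁ | 2 => h₂
  obtain ⟨g, hg, hfg⟩ := exists_inGeneralPosition f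
  refine not_forall_cross_eq_false hg fun a b c d ⟨⟨hac, had, hbc, hbd⟩, k, hab, hcd⟩ => ?_
  exact cross_eq_false_of_disjoint (hg _ _ _ hab.ne hac hbc) (hg _ _ _ hab.ne had hbd)
    (hg _ _ _ hcd.ne hac.symm had.symm) (hg _ _ _ hcd.ne hbc.symm hbd.symm)
    (hfg _ _ _ _ ((hf k).disjoint_segment hab hcd hac had hbc hbd))
end

section
/- There exist a natural number n and two simple graphs G₁ and G₂ on the common vertex set Fin n, each of which individually admits a crossing-free straight-line drawing in ℝ², such that no single injective map f : Fin n → ℝ² is simultaneously a crossing-free straight-line drawing of both G₁ and G₂. That is, two planar graphs with a given vertex mapping cannot always be simultaneously embedded. -/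
/-- Twice the signed area of the triangle `p q r`. -/
def planeOrientation {R : Type*} [CommRing R] (p q r : R × R) : R :=
  (q.1 - p.1) * (r.2 - p.2) - (q.2 - p.2) * (r.1 - p.1)

/-- Segments joining disjoint pairs of indices do not meet. -/
def PairwiseDisjointSegments {V : Type*} (p : V → ℝ × ℝ) : Prop :=
  ∀ i j k l : V, i ≠ j → i ≠ k → i ≠ l → j ≠ k → j ≠ l → k ≠ l →
    Disjoint (segment ℝ (p i) (p j)) (segment ℝ (p k) (p l))

theorem mem_segment_plane_iff (a b x : ℝ × ℝ) :
    x ∈ segment ℝ a b ↔ ∃ t : ℝ, 0 ≤ t ∧ t ≤ 1 ∧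
      x.1 = (1 - t) * a.1 + t * b.1 ∧ x.2 = (1 - t) * a.2 + t * b.2 := by
  constructor
  · rintro ⟨s, t, hs, ht, hst, rfl⟩
    obtain rfl : s = 1 - t := by linarith
    exact ⟨t, ht, by linarith, by simp, by simp⟩
  · rintro ⟨t, h0, h1, hx, hy⟩
    exact ⟨1 - t, t, by linarith, h0, by ring, Prod.ext (by simp [hx]) (by simp [hy])⟩

theorem exists_smul_of_cross_eq_zero {u v : ℝ × ℝ} (hu : u ≠ 0)
    (h : u.1 * v.2 - u.2 * v.1 = 0) : ∃ r : ℝ, v = r • u := by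
  by_cases h1 : u.1 = 0
  · have h2 : u.2 ≠ 0 := fun h2 => hu (Prod.ext h1 h2)
    refine ⟨v.2 / u.2, Prod.ext ?_ ?_⟩
    · simp only [Prod.smul_fst, smul_eq_mul]
      field_simp
      linear_combination -h
    · simp [h2]
  · refine ⟨v.1 / u.1, Prod.ext ?_ ?_⟩
    · simp [h1]
    · simp only [Prod.smul_snd, smul_eq_mul]
      field_simp
      linear_combination h

theorem mem_segment_of_planeOrientation_eq_zero {a b c : ℝ × ℝ}
    (h : planeOrientation a b c = 0) :
    b ∈ segment ℝ a c ∨ c ∈ segment ℝ b a ∨ a ∈ segment ℝ c b := by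
  by_cases hab : b = a
  · subst hab
    exact Or.inl (left_mem_segment ℝ _ _)
  obtain ⟨r, hr⟩ := exists_smul_of_cross_eq_zero (v := c - a) (sub_ne_zero.mpr hab) h
  have hcol : Collinear ℝ ({a, b, c} : Set (ℝ × ℝ)) := by
    rw [collinear_iff_of_mem (p₀ := a) (by simp)]
    refine ⟨b - a, ?_⟩
    rintro x (rfl | rfl | rfl)
    · exact ⟨0, by simp⟩
    · exact ⟨1, by simp⟩
    · exact ⟨r, by rw [← hr]; simp⟩
  simpa only [mem_segment_iff_wbtw] using hcol.wbtw_or_wbtw_or_wbtw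

namespace PairwiseDisjointSegments

variable {p : Fin 5 → ℝ × ℝ}

theorem notMem_segment (hp : PairwiseDisjointSegments p) {i j k : Fin 5}
    (hij : i ≠ j) (hik : i ≠ k) (hjk : j ≠ k) : p k ∉ segment ℝ (p i) (p j) := by
  obtain ⟨l, hli, hlj, hlk⟩ : ∃ l, l ≠ i ∧ l ≠ j ∧ l ≠ k := by
    revert i j k
    decide
  intro h
  exact Set.disjoint_left.mp (hp i j k l hij hik hli.symm hjk hlj.symm hlk.symm) h
    (left_mem_segment ℝ _ _)

theorem planeOrientation_ne_zero (hp : PairwiseDisjointSegments p) {i j k : Fin 5}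
    (hij : i ≠ j) (hik : i ≠ k) (hjk : j ≠ k) : planeOrientation (p i) (p j) (p k) ≠ 0 := by
  intro h
  rcases mem_segment_of_planeOrientation_eq_zero h with h | h | h
  · exact hp.notMem_segment hik hij hjk.symm h
  · exact hp.notMem_segment hij.symm hjk hik h
  · exact hp.notMem_segment hjk.symm hik.symm hij.symm h

end PairwiseDisjointSegments

/-- If `d` lies inside the triangle `a b c` and `e` lies in the cone at `d` spanned by `a` and
`b`, then two of the segments with disjoint endpoint pairs meet. -/
theorem segments_meet_of_mem_cone {a b c d e : ℝ × ℝ} {α β γ x y : ℝ}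
    (hα : 0 < α) (hβ : 0 < β) (hγ : 0 < γ) (hsum : α + β + γ = 1)
    (hd : d = α • a + β • b + γ • c) (hx : 0 ≤ x) (hy : 0 ≤ y)
    (he : e - d = x • (a - d) + y • (b - d)) :
    ¬ Disjoint (segment ℝ d e) (segment ℝ a b) ∨
      ¬ Disjoint (segment ℝ e c) (segment ℝ d b) ∨
      ¬ Disjoint (segment ℝ e c) (segment ℝ d a) := by
  obtain rfl : γ = 1 - α - β := by linarith
  have hd1 := congrArg Prod.fst hd
  have hd2 := congrArg Prod.snd hd
  have he1 := congrArg Prod.fst he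
  have he2 := congrArg Prod.snd he
  simp only [Prod.fst_add, Prod.snd_add, Prod.smul_fst, Prod.smul_snd, smul_eq_mul,
    Prod.fst_sub, Prod.snd_sub] at hd1 hd2 he1 he2
  rcases le_or_gt 1 (x + y) with h | h
  · left
    have hpos : 0 < x + y := by linarith
    rw [Set.not_disjoint_iff]
    refine ⟨(x / (x + y)) • a + (y / (x + y)) • b, ?_, ?_⟩
    · rw [mem_segment_plane_iff]
      refine ⟨1 / (x + y), by positivity, by rw [div_le_one hpos]; exact h, ?_, ?_⟩
      · simp only [Prod.fst_add, Prod.smul_fst, smul_eq_mul]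
        field_simp
        linear_combination -he1
      · simp only [Prod.snd_add, Prod.smul_snd, smul_eq_mul]
        field_simp
        linear_combination -he2
    · exact ⟨_, _, by positivity, by positivity, by field_simp, rfl⟩
  · right
    rcases le_total (x * β) (y * α) with hxy | hxy
    · left
      have hpos : 0 < (1 - α - β) * x + α := by positivity
      rw [Set.not_disjoint_iff]
      set s := (α * y - x * β) / ((1 - α - β) * x + α) with hs
      refine ⟨((1 - s) * d.1 + s * b.1, (1 - s) * d.2 + s * b.2), ?_, ?_⟩
      · rw [mem_segment_plane_iff]
        refine ⟨(1 - α - β) * x / ((1 - α - β) * x + α), by positivity, ?_, ?_, ?_⟩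
        · rw [div_le_one hpos]; linarith
        · simp only [hs]
          field_simp
          linear_combination x * hd1 - α * he1
        · simp only [hs]
          field_simp
          linear_combination x * hd2 - α * he2
      · rw [mem_segment_plane_iff]
        refine ⟨s, div_nonneg (by linarith) hpos.le, ?_, rfl, rfl⟩
        rw [hs, div_le_one hpos]
        nlinarith [mul_nonneg hx hγ.le, mul_nonneg hx hβ.le]
    · right
      have hpos : 0 < (1 - α - β) * y + β := by positivity
      rw [Set.not_disjoint_iff]
      set s := (β * x - y * α) / ((1 - α - β) * y + β) with hs
      refine ⟨((1 - s) * d.1 + s * a.1, (1 - s) * d.2 + s * a.2), ?_, ?_⟩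
      · rw [mem_segment_plane_iff]
        refine ⟨(1 - α - β) * y / ((1 - α - β) * y + β), by positivity, ?_, ?_, ?_⟩
        · rw [div_le_one hpos]; linarith
        · simp only [hs]
          field_simp
          linear_combination y * hd1 - β * he1
        · simp only [hs]
          field_simp
          linear_combination y * hd2 - β * he2
      · rw [mem_segment_plane_iff]
        refine ⟨s, div_nonneg (by linarith) hpos.le, ?_, rfl, rfl⟩
        rw [hs, div_le_one hpos]
        nlinarith [mul_nonneg hy hγ.le, mul_nonneg hy hα.le]

/-- A plane vector lies in one of the three cones spanned by two of three positively dependent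
vectors. -/
theorem mem_cone_of_positive_dependence {u v w z : ℝ × ℝ} {α β γ : ℝ}
    (hα : 0 < α) (hβ : 0 < β) (hγ : 0 < γ)
    (h : α • u + β • v + γ • w = 0) (huv : u.1 * v.2 - u.2 * v.1 ≠ 0) :
    ∃ x y : ℝ, 0 ≤ x ∧ 0 ≤ y ∧
      (z = x • u + y • v ∨ z = x • v + y • w ∨ z = x • w + y • u) := by
  set D := u.1 * v.2 - u.2 * v.1 with hD
  obtain ⟨x, y, hz⟩ : ∃ x y : ℝ, z = x • u + y • v := by
    refine ⟨(z.1 * v.2 - z.2 * v.1) / D, (u.1 * z.2 - u.2 * z.1) / D, Prod.ext ?_ ?_⟩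
    · simp only [Prod.fst_add, Prod.smul_fst, smul_eq_mul]
      field_simp
      rw [hD]; ring
    · simp only [Prod.snd_add, Prod.smul_snd, smul_eq_mul]
      field_simp
      rw [hD]; ring
  have shift (s : ℝ) : z = (x + s * α) • u + (y + s * β) • v + (s * γ) • w := by
    calc z = x • u + y • v + s • (α • u + β • v + γ • w) := by rw [h, hz]; simp
      _ = _ := by module
  by_cases hxy : 0 ≤ x ∧ 0 ≤ y
  · exact ⟨x, y, hxy.1, hxy.2, Or.inl hz⟩
  rcases le_total (x * β) (y * α) with hle | hle
  · have hx : x ≤ 0 := by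
      by_contra! hx
      exact hxy ⟨hx.le, by nlinarith [mul_pos hx hβ]⟩
    refine ⟨y + -x / α * β, -x / α * γ, ?_, ?_, Or.inr (Or.inl ?_)⟩
    · have : y + -x / α * β = (y * α - x * β) / α := by field_simp; ring
      rw [this]
      exact div_nonneg (by linarith) hα.le
    · exact mul_nonneg (div_nonneg (by linarith) hα.le) hγ.le
    · have h0 : x + -x / α * α = 0 := by field_simp; ring
      simpa [h0] using shift (-x / α)
  · have hy : y ≤ 0 := by
      by_contra! hy
      exact hxy ⟨by nlinarith [mul_pos hy hα], hy.le⟩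
    refine ⟨-y / β * γ, x + -y / β * α, ?_, ?_, Or.inr (Or.inr ?_)⟩
    · exact mul_nonneg (div_nonneg (by linarith) hβ.le) hγ.le
    · have : x + -y / β * α = (x * β - y * α) / β := by field_simp; ring
      rw [this]
      exact div_nonneg (by linarith) hβ.le
    · have h0 : y + -y / β * β = 0 := by field_simp; ring
      have := shift (-y / β)
      rw [h0, zero_smul, add_zero, add_comm] at this
      exact this

namespace PairwiseDisjointSegments

variable {p : Fin 5 → ℝ × ℝ}

/-- No point is a strictly convex combination of three others. -/
theorem ne_convexCombination (hp : PairwiseDisjointSegments p) {i j k l m : Fin 5}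
    (hij : i ≠ j) (hik : i ≠ k) (hil : i ≠ l) (him : i ≠ m) (hjk : j ≠ k) (hjl : j ≠ l)
    (hjm : j ≠ m) (hkl : k ≠ l) (hkm : k ≠ m) (hlm : l ≠ m) {α β γ : ℝ}
    (hα : 0 < α) (hβ : 0 < β) (hγ : 0 < γ) (hsum : α + β + γ = 1) :
    p l ≠ α • p i + β • p j + γ • p k := by
  intro hd
  have hdep : α • (p i - p l) + β • (p j - p l) + γ • (p k - p l) = 0 := by
    calc _ = α • p i + β • p j + γ • p k - (α + β + γ) • p l := by module
      _ = 0 := by rw [hsum, one_smul, ← hd, sub_self]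
  obtain ⟨x, y, hx, hy, h | h | h⟩ := mem_cone_of_positive_dependence (z := p m - p l)
    hα hβ hγ hdep (hp.planeOrientation_ne_zero hil.symm hjl.symm hij)
  · rcases segments_meet_of_mem_cone hα hβ hγ hsum hd hx hy h with h | h | h <;>
    · refine h (hp _ _ _ _ ?_ ?_ ?_ ?_ ?_ ?_) <;> first | assumption | (symm; assumption)
  · rcases segments_meet_of_mem_cone (c := p i) hβ hγ hα (by linarith) (hd.trans (by module)) hx hy
      h with h | h | h <;>
    · refine h (hp _ _ _ _ ?_ ?_ ?_ ?_ ?_ ?_) <;> first | assumption | (symm; assumption)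
  · rcases segments_meet_of_mem_cone (c := p j) hγ hα hβ (by linarith) (hd.trans (by module)) hx hy
      h with h | h | h <;>
    · refine h (hp _ _ _ _ ?_ ?_ ?_ ?_ ?_ ?_) <;> first | assumption | (symm; assumption)

end PairwiseDisjointSegments

/-- Four points in the plane satisfy an affine dependence given by signed areas. -/
theorem exists_affine_dependence (q : Fin 4 → ℝ × ℝ)
    (hq : ∀ i j k, i ≠ j → i ≠ k → j ≠ k → planeOrientation (q i) (q j) (q k) ≠ 0) :
    ∃ w : Fin 4 → ℝ, (∀ i, w i ≠ 0) ∧ ∑ i, w i = 0 ∧ ∑ i, w i • q i = 0 := by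
  refine ⟨![planeOrientation (q 1) (q 2) (q 3), -planeOrientation (q 0) (q 2) (q 3),
    planeOrientation (q 0) (q 1) (q 3), -planeOrientation (q 0) (q 1) (q 2)], ?_, ?_, ?_⟩
  · intro i
    fin_cases i
    · exact hq 1 2 3 (by decide) (by decide) (by decide)
    · exact neg_ne_zero.mpr (hq 0 2 3 (by decide) (by decide) (by decide))
    · exact hq 0 1 3 (by decide) (by decide) (by decide)
    · exact neg_ne_zero.mpr (hq 0 1 2 (by decide) (by decide) (by decide))
  · simp [Fin.sum_univ_four, planeOrientation]
    ring
  · refine Prod.ext ?_ ?_ <;> simp [Fin.sum_univ_four, planeOrientation] <;> ring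

/-- The complete graph on five vertices has no straight-line drawing in which independent edges
are disjoint. -/
theorem not_pairwiseDisjointSegments (p : Fin 5 → ℝ × ℝ) : ¬ PairwiseDisjointSegments p := by
  intro hp
  obtain ⟨w, hw, hsum, hdep⟩ := exists_affine_dependence (fun i => p i.castSucc) (by
    intro i j k hij hik hjk
    apply hp.planeOrientation_ne_zero <;> simpa)
  let σ := Tuple.sort w
  have hmono : Monotone (w ∘ σ) := Tuple.monotone_sort w
  rw [← Equiv.sum_comp σ] at hsum hdep
  rw [Fin.sum_univ_four] at hsum hdep
  have h01 : w (σ 0) ≤ w (σ 1) := hmono (by decide)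
  have h12 : w (σ 1) ≤ w (σ 2) := hmono (by decide)
  have h23 : w (σ 2) ≤ w (σ 3) := hmono (by decide)
  have hw0 := hw (σ 0)
  have hw1 := hw (σ 1)
  have hw2 := hw (σ 2)
  have hw3 := hw (σ 3)
  have n01 : (σ 0).castSucc ≠ (σ 1).castSucc := by simp
  have n02 : (σ 0).castSucc ≠ (σ 2).castSucc := by simp
  have n03 : (σ 0).castSucc ≠ (σ 3).castSucc := by simp
  have n12 : (σ 1).castSucc ≠ (σ 2).castSucc := by simp
  have n13 : (σ 1).castSucc ≠ (σ 3).castSucc := by simp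
  have n23 : (σ 2).castSucc ≠ (σ 3).castSucc := by simp
  have n4 (i : Fin 4) : i.castSucc ≠ 4 := (Fin.castSucc_lt_last i).ne
  generalize w (σ 0) = w₀ at *
  generalize w (σ 1) = w₁ at *
  generalize w (σ 2) = w₂ at *
  generalize w (σ 3) = w₃ at *
  have hneg : w₀ < 0 := by
    by_contra! h
    exact hw0 (by linarith)
  have hpos : 0 < w₃ := by
    by_contra! h
    exact hw3 (by linarith)
  have hd1 := congrArg Prod.fst hdep
  have hd2 := congrArg Prod.snd hdep
  simp only [Prod.fst_add, Prod.snd_add, Prod.smul_fst, Prod.smul_snd, smul_eq_mul,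
    Prod.fst_zero, Prod.snd_zero] at hd1 hd2
  rcases lt_or_gt_of_ne hw1 with h1 | h1
  · rcases lt_or_gt_of_ne hw2 with h2 | h2
    · refine hp.ne_convexCombination n01 n02 n03 (n4 _) n12 n13 (n4 _) n23 (n4 _) (n4 _)
        (α := -w₀ / w₃) (β := -w₁ / w₃) (γ := -w₂ / w₃) (div_pos (by linarith) hpos)
        (div_pos (by linarith) hpos) (div_pos (by linarith) hpos) ?_ (Prod.ext ?_ ?_)
      · field_simp
        linarith
      · simp only [Prod.fst_add, Prod.smul_fst, smul_eq_mul]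
        field_simp
        linear_combination hd1
      · simp only [Prod.snd_add, Prod.smul_snd, smul_eq_mul]
        field_simp
        linear_combination hd2
    · have hs : 0 < w₂ + w₃ := by linarith
      refine Set.disjoint_left.mp (hp _ _ _ _ n01 n02 n03 n12 n13 n23)
        ⟨-w₀ / (w₂ + w₃), -w₁ / (w₂ + w₃), div_nonneg (by linarith) hs.le,
          div_nonneg (by linarith) hs.le, ?_, rfl⟩
        ⟨w₂ / (w₂ + w₃), w₃ / (w₂ + w₃), by positivity, by positivity, ?_, Prod.ext ?_ ?_⟩
      · field_simp
        linarith
      · field_simp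
      · simp only [Prod.fst_add, Prod.smul_fst, smul_eq_mul]
        field_simp
        linear_combination hd1
      · simp only [Prod.snd_add, Prod.smul_snd, smul_eq_mul]
        field_simp
        linear_combination hd2
  · have hneg' : 0 < -w₀ := by linarith
    have hne : -w₀ ≠ 0 := hneg'.ne'
    refine hp.ne_convexCombination n12 n13 n01.symm (n4 _) n23 n02.symm (n4 _) n03.symm (n4 _) (n4 _)
      (α := w₁ / -w₀) (β := w₂ / -w₀) (γ := w₃ / -w₀) (div_pos h1 hneg')
      (div_pos (by linarith) hneg') (div_pos hpos hneg') ?_ (Prod.ext ?_ ?_)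
    · rw [← add_div, ← add_div, div_eq_one_iff_eq hne]
      linarith
    · simp only [Prod.fst_add, Prod.smul_fst, smul_eq_mul]
      field_simp
      linear_combination hd1
    · simp only [Prod.snd_add, Prod.smul_snd, smul_eq_mul]
      field_simp
      linear_combination hd2

theorem disjoint_segment_of_same_side {a b c d : ℝ × ℝ}
    (h : 0 < planeOrientation a b c * planeOrientation a b d) :
    Disjoint (segment ℝ a b) (segment ℝ c d) := by
  rw [Set.disjoint_left]
  intro x hx hy
  rw [mem_segment_plane_iff] at hx hy
  obtain ⟨s, -, -, hs1, hs2⟩ := hx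
  obtain ⟨t, ht0, ht1, h1, h2⟩ := hy
  have hz : (1 - t) * planeOrientation a b c + t * planeOrientation a b d = 0 := by
    rw [hs1] at h1
    rw [hs2] at h2
    unfold planeOrientation
    linear_combination (b.2 - a.2) * h1 - (b.1 - a.1) * h2
  have ht : 0 ≤ 1 - t := by linarith
  rcases pos_and_pos_or_neg_and_neg_of_mul_pos h with ⟨hc, hd⟩ | ⟨hc, hd⟩
  · nlinarith [mul_nonneg ht hc.le, mul_nonneg ht0 hd.le]
  · nlinarith [mul_nonneg ht (neg_nonneg.mpr hc.le), mul_nonneg ht0 (neg_nonneg.mpr hd.le)]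

theorem segment_inter_segment_of_planeOrientation_ne_zero {a b c : ℝ × ℝ}
    (h : planeOrientation a b c ≠ 0) : segment ℝ a b ∩ segment ℝ a c = {a} := by
  apply Set.Subset.antisymm
  · rintro x ⟨hx, hy⟩
    rw [mem_segment_plane_iff] at hx hy
    obtain ⟨s, -, -, hs1, hs2⟩ := hx
    obtain ⟨t, -, -, h1, h2⟩ := hy
    have hz : t * planeOrientation a b c = 0 := by
      rw [hs1] at h1
      rw [hs2] at h2
      unfold planeOrientation
      linear_combination (b.2 - a.2) * h1 - (b.1 - a.1) * h2
    have ht : t = 0 := (mul_eq_zero.mp hz).resolve_right h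
    subst ht
    exact Prod.ext (by simpa using h1) (by simpa using h2)
  · rintro x rfl
    exact ⟨left_mem_segment ℝ _ _, left_mem_segment ℝ _ _⟩

/-- A drawing in general position is crossing-free if, for any two independent edges, one of them
has both endpoints strictly on one side of the line through the other. -/
theorem isCrossingFreeDrawing_of_planeOrientation {V : Type*} {G : SimpleGraph V}
    {f : V → ℝ × ℝ} (hf : Function.Injective f)
    (hgen : ∀ a b c, a ≠ b → a ≠ c → b ≠ c → planeOrientation (f a) (f b) (f c) ≠ 0)
    (hsep : ∀ a b c d, G.Adj a b → G.Adj c d → a ≠ c → a ≠ d → b ≠ c → b ≠ d →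
      0 < planeOrientation (f a) (f b) (f c) * planeOrientation (f a) (f b) (f d) ∨
      0 < planeOrientation (f c) (f d) (f a) * planeOrientation (f c) (f d) (f b)) :
    IsCrossingFreeDrawing G f := by
  have key (a b c : V) (hab : G.Adj a b) (hac : G.Adj a c) (hbc : b ≠ c) :
      segment ℝ (f a) (f b) ∩ segment ℝ (f a) (f c) = f '' (({a, b} : Set V) ∩ {a, c}) := by
    rw [segment_inter_segment_of_planeOrientation_ne_zero (hgen a b c hab.ne hac.ne hbc)]
    have : ({a, b} : Set V) ∩ {a, c} = {a} := by
      rw [← Set.insert_inter_distrib, Set.singleton_inter_eq_empty.mpr (by simpa using hbc)]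
      simp
    rw [this, Set.image_singleton]
  refine ⟨hf, fun a b c d hab hcd hne => ?_⟩
  by_cases hac : a = c
  · subst hac
    exact key a b d hab hcd (fun h => hne (by rw [h]))
  by_cases had : a = d
  · subst had
    rw [segment_symm ℝ (f c), Set.pair_comm c]
    exact key a b c hab hcd.symm (fun h => hne (by rw [h, Sym2.eq_swap]))
  by_cases hbc : b = c
  · subst hbc
    rw [segment_symm ℝ (f a), Set.pair_comm a]
    exact key b a d hab.symm hcd had
  by_cases hbd : b = d
  · subst hbd
    rw [segment_symm ℝ (f a), Set.pair_comm a, segment_symm ℝ (f c), Set.pair_comm c]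
    exact key b a c hab.symm hcd.symm hac
  have hempty : ({a, b} : Set V) ∩ {c, d} = ∅ := by
    rw [← Set.disjoint_iff_inter_eq_empty]
    simp [hac, had, hbc, hbd, eq_comm]
  rw [hempty, Set.image_empty, ← Set.disjoint_iff_inter_eq_empty]
  rcases hsep a b c d hab hcd hac had hbc hbd with h | h
  · exact disjoint_segment_of_same_side h
  · exact (disjoint_segment_of_same_side h).symm

/-- The complete graph on five vertices with the edge `uv` removed. -/
def completeMinusEdge (u v : Fin 5) : SimpleGraph (Fin 5) where
  Adj a b := a ≠ b ∧ s(a, b) ≠ s(u, v)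
  symm := ⟨fun a b h => ⟨h.1.symm, by rw [Sym2.eq_swap]; exact h.2⟩⟩
  loopless := ⟨fun _ h => h.1 rfl⟩

instance (u v : Fin 5) : DecidableRel (completeMinusEdge u v).Adj :=
  fun a b => inferInstanceAs (Decidable (a ≠ b ∧ s(a, b) ≠ s(u, v)))

theorem planeOrientation_intCast (p q r : ℤ × ℤ) :
    planeOrientation ((p.1 : ℝ), (p.2 : ℝ)) (q.1, q.2) (r.1, r.2) =
      ((planeOrientation p q r : ℤ) : ℝ) := by
  simp [planeOrientation]

theorem isCrossingFreeDrawing_intCast {V : Type*} {G : SimpleGraph V} {g : V → ℤ × ℤ}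
    (hg : ∀ a b, g a = g b → a = b)
    (hgen : ∀ a b c, a ≠ b → a ≠ c → b ≠ c → planeOrientation (g a) (g b) (g c) ≠ 0)
    (hsep : ∀ a b c d, G.Adj a b → G.Adj c d → a ≠ c → a ≠ d → b ≠ c → b ≠ d →
      0 < planeOrientation (g a) (g b) (g c) * planeOrientation (g a) (g b) (g d) ∨
      0 < planeOrientation (g c) (g d) (g a) * planeOrientation (g c) (g d) (g b)) :
    IsCrossingFreeDrawing G (fun v => (((g v).1 : ℝ), ((g v).2 : ℝ))) := by
  apply isCrossingFreeDrawing_of_planeOrientation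
  · intro a b h
    simp only [Prod.mk.injEq, Int.cast_inj] at h
    exact hg a b (Prod.ext h.1 h.2)
  · intro a b c hab hac hbc
    rw [planeOrientation_intCast]
    exact_mod_cast hgen a b c hab hac hbc
  · intro a b c d hab hcd hac had hbc hbd
    simp only [planeOrientation_intCast]
    exact_mod_cast hsep a b c d hab hcd hac had hbc hbd

set_option maxRecDepth 100000 in
set_option maxHeartbeats 1000000 in
theorem exists_drawing_completeMinusEdge_zero_one :
    ∃ f, IsCrossingFreeDrawing (completeMinusEdge 0 1) f := by
  refine ⟨_, isCrossingFreeDrawing_intCast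
    (g := ![(6, 2), (5, 12), (0, 0), (12, 0), (6, 6)]) (by decide) ?_ ?_⟩ <;>
  · unfold planeOrientation
    decide

set_option maxRecDepth 100000 in
set_option maxHeartbeats 1000000 in
theorem exists_drawing_completeMinusEdge_zero_two :
    ∃ f, IsCrossingFreeDrawing (completeMinusEdge 0 2) f := by
  refine ⟨_, isCrossingFreeDrawing_intCast
    (g := ![(6, 2), (0, 0), (5, 12), (12, 0), (6, 6)]) (by decide) ?_ ?_⟩ <;>
  · unfold planeOrientation
    decide

/-- Two planar graphs with a given vertex mapping cannot always be simultaneously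
embedded: there are two graphs on a common vertex set, each admitting a
crossing-free straight-line drawing, with no common such drawing. -/
theorem two_planar_graphs_not_always_simultaneously_embeddable :
    ∃ (n : ℕ) (G₁ G₂ : SimpleGraph (Fin n)),
      (∃ f : Fin n → ℝ × ℝ, IsCrossingFreeDrawing G₁ f) ∧
      (∃ f : Fin n → ℝ × ℝ, IsCrossingFreeDrawing G₂ f) ∧
      ∀ f : Fin n → ℝ × ℝ,
        ¬ (IsCrossingFreeDrawing G₁ f ∧ IsCrossingFreeDrawing G₂ f) := by
  refine ⟨5, completeMinusEdge 0 1, completeMinusEdge 0 2,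
    exists_drawing_completeMinusEdge_zero_one, exists_drawing_completeMinusEdge_zero_two, ?_⟩
  rintro f ⟨h₁, h₂⟩
  refine not_pairwiseDisjointSegments f fun i j k l hij hik hil hjk hjl hkl => ?_
  have hempty : ({i, j} : Set (Fin 5)) ∩ {k, l} = ∅ := by
    rw [← Set.disjoint_iff_inter_eq_empty]
    simp [hik, hil, hjk, hjl, eq_comm]
  have hne : s(i, j) ≠ s(k, l) := by
    simp [hik, hil]
  have hG : ((completeMinusEdge 0 1).Adj i j ∧ (completeMinusEdge 0 1).Adj k l) ∨
      ((completeMinusEdge 0 2).Adj i j ∧ (completeMinusEdge 0 2).Adj k l) := by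
    clear hempty hne
    revert i j k l
    decide
  rw [Set.disjoint_iff_inter_eq_empty]
  rcases hG with ⟨hij', hkl'⟩ | ⟨hij', hkl'⟩
  · rw [h₁.2 i j k l hij' hkl' hne, hempty, Set.image_empty]
  · rw [h₂.2 i j k l hij' hkl' hne, hempty, Set.image_empty]
end
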